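/- arXiv:2202.05651 — 2 statements merged into one kernel-verified Lean document; each statement's English description precedes it below -/
import Mathlib

section
/- Let X be a finite set of Boolean variables partitioned into blocks, F an r-DNF over X, and ρ a block restriction. The canonical decision tree T(F,ρ) correctly decides F↾g(ρ): for every branch of T(F,ρ), if π is the assignment given by the answers along that branch, then the output label at the end of the branch equals the truth value of F↾g(ρ)π. Moreover, along any branch no block is queried more than once, and the moment a block is queried all of its variables are given 0/1 values. -/
/-- A binary decision tree querying Boolean variables. -/
inductive DTree (X : Type) where
  | leaf : Bool → DTree X
  | node : X → DTree X → DTree X → DTree X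

namespace DTree

/-- The branches of a decision tree (in left-to-right order, `false`-child first),
each given as the list of query/answer pairs along it together with the leaf label. -/
def branches {X : Type} : DTree X → List (List (X × Bool) × Bool)
  | .leaf b => [([], b)]
  | .node x t0 t1 =>
      ((branches t0).map fun p => ((x, false) :: p.1, p.2)) ++
      ((branches t1).map fun p => ((x, true) :: p.1, p.2))

/-- The height of a decision tree: the maximum number of queries along any branch. -/
def height {X : Type} (t : DTree X) : ℕ :=
  ((branches t).map fun p => p.1.length).foldr max 0

end DTree

/-- A restriction: each variable is set to `0`/`1` (`some false`/`some true`)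
or left unset/starred (`none`). -/
abbrev Restriction (X : Type) := X → Option Bool

/-- A term: a conjunction of literals, each literal a variable with a sign. -/
abbrev Term (X : Type) := List (X × Bool)

/-- A DNF: an ordered list of terms. -/
abbrev DNF (X : Type) := List (Term X)

/-- `F` is an `r`-DNF: every term has at most `r` literals. -/
def IsRDNF {X : Type} (r : ℕ) (F : DNF X) : Prop := ∀ C ∈ F, C.length ≤ r

/-- `C↾ρ ≡ 0`: some literal of `C` is falsified by `ρ`. -/
def falsified {X : Type} (ρ : Restriction X) (C : Term X) : Bool :=
  C.any fun l => decide (ρ l.1 = some (!l.2))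

/-- `C` is satisfied by `ρ`: every literal of `C` is made true. -/
def satisfied {X : Type} (ρ : Restriction X) (C : Term X) : Bool :=
  C.all fun l => decide (ρ l.1 = some l.2)

/-- Set the variable `x` to the Boolean value `b` in `ρ`. -/
def setVar {X : Type} [DecidableEq X] (ρ : Restriction X) (x : X) (b : Bool) : Restriction X :=
  fun y => if y = x then some b else ρ y

/-- Extend `ρ` by an assignment given as a list of variable/value pairs. -/
def extendL {X : Type} [DecidableEq X] (ρ : Restriction X) (l : List (X × Bool)) :
    Restriction X :=
  l.foldl (fun ρ' e => setVar ρ' e.1 e.2) ρ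

/-- Remove duplicates from a list, keeping the first occurrence of each element. -/
def firstDedup {X : Type} [DecidableEq X] : List X → List X
  | [] => []
  | x :: xs => x :: (firstDedup xs).filter (fun y => decide (y ≠ x))

/-- The variables that appear starred in `C↾ρ`, in order of appearance. -/
def starredVars {X : Type} [DecidableEq X] (ρ : Restriction X) (C : Term X) : List X :=
  firstDedup ((C.map Prod.fst).filter fun x => decide (ρ x = none))

/-- Query the variables in the list in order; when done, output `1` if `C` has become
satisfied and otherwise continue with the procedure `k`. -/
def queryList {X : Type} [DecidableEq X] (k : Restriction X → DTree X) (C : Term X) :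
    List X → Restriction X → DTree X
  | [], ρ => if satisfied ρ C then .leaf true else k ρ
  | x :: rest, ρ =>
      .node x (queryList k C rest (setVar ρ x false)) (queryList k C rest (setVar ρ x true))

/-- The canonical decision tree `T(F,ρ)` (with a fuel parameter; taking
`fuel = card X + 1` always suffices since every round queries at least one variable):
look for the first term `C` of `F` with `C↾ρ` not identically `0`; if none, output `0`;
otherwise query in order all variables starred in `C↾ρ`; if `C` became satisfied output `1`,
else repeat with the extended restriction. -/
def canonTree {X : Type} [DecidableEq X] : ℕ → DNF X → Restriction X → DTree X
  | 0, _, _ => .leaf false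
  | fuel + 1, F, ρ =>
      match F.find? (fun C => !falsified ρ C) with
      | none => .leaf false
      | some C => queryList (fun ρ' => canonTree fuel F ρ') C (starredVars ρ C) ρ

/-- The canonical decision tree `T(F,ρ)`. -/
def canonT {X : Type} [Fintype X] [DecidableEq X] (F : DNF X) (ρ : Restriction X) : DTree X :=
  canonTree (Fintype.card X + 1) F ρ

/-- The weight of a restriction: each starred variable contributes `p` and each set
variable contributes `(1-p)/2`, so a restriction with `a` ones, `b` zeros and `c`
stars has weight `((1-p)/2)^(a+b) * p^c`. -/
noncomputable def weightR {X : Type} [Fintype X] (p : ℝ) (ρ : Restriction X) : ℝ :=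
  ∏ x : X, if ρ x = none then p else (1 - p) / 2

/-- `ρ` is a block restriction with respect to the block structure `B : X → ι`:
every variable is `1` or starred or `0`, and within each block the non-`1` variables are
either all `0` (a `0`-block) or all starred (a `*`-block). -/
def BlockRes {X ι : Type} (B : X → ι) (ρ : Restriction X) : Prop :=
  ∀ i : ι, (∀ x, B x = i → ρ x ≠ some false) ∨ (∀ x, B x = i → ρ x ≠ none)


instance {X ι : Type} [Fintype X] [Fintype ι] [DecidableEq ι] (B : X → ι)
    (ρ : Restriction X) : Decidable (BlockRes B ρ) := by
  unfold BlockRes; infer_instance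

/-- The weight of a block restriction: the product over blocks, where a block with
`a` ones and `b > 0` non-ones has weight `(1-p)^a p^b (1-q)` if it is a `0`-block and
`(1-p)^a p^b q` if it is a `*`-block, and an all-ones block `B` has weight `(1-p)^|B|`. -/
noncomputable def blockWeight {X ι : Type} [Fintype X] [Fintype ι] [DecidableEq ι]
    (p q : ℝ) (B : X → ι) (ρ : Restriction X) : ℝ :=
  ∏ i : ι,
    ((∏ x ∈ Finset.univ.filter fun x => B x = i,
        if ρ x = some true then 1 - p else p) *
      (if ∃ x, B x = i ∧ ρ x = some false then 1 - q
       else if ∃ x, B x = i ∧ ρ x = none then q else 1))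

/-- The restriction `g(ρ)`: it extends `ρ` by setting, in each `*`-block, every starred
variable except the first one to `1`. -/
def gRes {X ι : Type} [Fintype X] [LinearOrder X] [DecidableEq ι] (B : X → ι)
    (ρ : Restriction X) : Restriction X :=
  fun x => if ρ x = none ∧ ∃ y, B y = B x ∧ ρ y = none ∧ y < x then some true else ρ x

/-- The starred variables of block `i` under `ρ`, in increasing order. -/
def blockStars {X ι : Type} [Fintype X] [LinearOrder X] [DecidableEq ι] (B : X → ι)
    (ρ : Restriction X) (i : ι) : List X :=
  (Finset.univ.filter fun x => B x = i ∧ ρ x = none).sort (· ≤ ·)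

/-- Answer `b` to the query of the variable `x0` of block `i`: all starred variables of
the block are set to `1` except the queried one, which is set according to the reply. -/
def setBlock {X ι : Type} [DecidableEq X] [DecidableEq ι] (B : X → ι) (ρ : Restriction X)
    (i : ι) (x0 : X) (b : Bool) : Restriction X :=
  fun x => if B x = i ∧ ρ x = none then (if x = x0 then some b else some true) else ρ x

/-- The blocks contributing a starred variable to `C↾ρ`, in order of appearance. -/
def blockList {X ι : Type} [DecidableEq X] [DecidableEq ι] (B : X → ι) (ρ : Restriction X)
    (C : Term X) : List ι :=
  firstDedup (((C.map Prod.fst).filter fun x => decide (ρ x = none)).map B)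

/-- Query the blocks in the list in order (the queried variable of a block is its first,
i.e. minimal, starred variable, the single starred variable of the block under `g(ρ)`);
when done, output `1` if `C` has become satisfied, else continue with `k`. -/
def queryBlocks {X ι : Type} [Fintype X] [LinearOrder X] [DecidableEq ι]
    (k : Restriction X → DTree X) (B : X → ι) (C : Term X) :
    List ι → Restriction X → DTree X
  | [], ρ => if satisfied ρ C then .leaf true else k ρ
  | i :: rest, ρ =>
      match (blockStars B ρ i).head? with
      | none => queryBlocks k B C rest ρ
      | some x0 =>
          .node x0 (queryBlocks k B C rest (setBlock B ρ i x0 false))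
                   (queryBlocks k B C rest (setBlock B ρ i x0 true))

/-- The canonical decision tree `T(F,ρ)` for block restrictions (with a fuel parameter;
`fuel = card X + 1` always suffices). -/
def canonTreeB {X ι : Type} [Fintype X] [LinearOrder X] [DecidableEq ι] (B : X → ι) :
    ℕ → DNF X → Restriction X → DTree X
  | 0, _, _ => .leaf false
  | fuel + 1, F, ρ =>
      match F.find? (fun C => !falsified ρ C) with
      | none => .leaf false
      | some C => queryBlocks (fun ρ' => canonTreeB B fuel F ρ') B C (blockList B ρ C) ρ

/-- The canonical decision tree `T(F,ρ)` for block restrictions. -/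
def canonTB {X ι : Type} [Fintype X] [LinearOrder X] [DecidableEq ι] (B : X → ι)
    (F : DNF X) (ρ : Restriction X) : DTree X :=
  canonTreeB B (Fintype.card X + 1) F ρ

/-- Setting a variable does not unset any other. -/
theorem setVar_ne_none {X : Type} [DecidableEq X] {ρ : Restriction X} {x : X} (y : X) (b : Bool)
    (h : ρ x ≠ none) : setVar ρ y b x ≠ none := by
  unfold setVar
  split_ifs <;> simp [h]

theorem extendL_ne_none {X : Type} [DecidableEq X] {x : X} (l : List (X × Bool)) :
    ∀ {ρ : Restriction X}, ρ x ≠ none → extendL ρ l x ≠ none := by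
  induction l with
  | nil => exact fun h => h
  | cons e l ih => exact fun h => ih (setVar_ne_none e.1 e.2 h)

theorem satisfied_of_not_falsified {X : Type} {ρ : Restriction X} {C : Term X}
    (hf : falsified ρ C = false) (hs : ∀ l ∈ C, ρ l.1 ≠ none) : satisfied ρ C = true := by
  simp only [satisfied, falsified, List.all_eq_true, List.any_eq_false, decide_eq_true_eq] at *
  intro l hl
  have h1 := hf l hl
  obtain ⟨b, hb⟩ := Option.ne_none_iff_exists'.mp (hs l hl)
  rw [hb] at h1 ⊢
  cases b <;> cases h2 : l.2 <;> simp_all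

theorem satisfied_mono {X : Type} {ρ σ : Restriction X} {C : Term X}
    (h : ∀ x b, ρ x = some b → σ x = some b) (hs : satisfied ρ C = true) :
    satisfied σ C = true := by
  simp only [satisfied, List.all_eq_true, decide_eq_true_eq] at *
  exact fun l hl => h _ _ (hs l hl)

theorem falsified_mono {X : Type} {ρ σ : Restriction X} {C : Term X}
    (h : ∀ x b, ρ x = some b → σ x = some b) (hf : falsified ρ C = true) :
    falsified σ C = true := by
  simp only [falsified, List.any_eq_true, decide_eq_true_eq] at *
  obtain ⟨l, hl, hx⟩ := hf
  exact ⟨l, hl, h _ _ hx⟩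

theorem setBlock_eq_none_iff {X ι : Type} [DecidableEq X] [DecidableEq ι]
    {B : X → ι} {ρ : Restriction X} {i : ι} {x y : X} {b : Bool} :
    setBlock B ρ i x b y = none ↔ B y ≠ i ∧ ρ y = none := by
  unfold setBlock
  split_ifs <;> simp_all
  tauto

theorem blockList_eq_nil {X ι : Type} [DecidableEq X] [DecidableEq ι]
    {B : X → ι} {ρ : Restriction X} {C : Term X}
    (h : blockList B ρ C = []) : ∀ l ∈ C, ρ l.1 ≠ none := by
  intro l hl hn
  have hmem : B l.1 ∈ ((C.map Prod.fst).filter fun x => decide (ρ x = none)).map B :=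
    List.mem_map_of_mem (List.mem_filter.mpr ⟨List.mem_map_of_mem hl, by simpa using hn⟩)
  unfold blockList at h
  cases hc : ((C.map Prod.fst).filter fun x => decide (ρ x = none)).map B with
  | nil => simp [hc] at hmem
  | cons a l => simp [hc, firstDedup] at h

theorem blockList_eq_cons {X ι : Type} [DecidableEq X] [DecidableEq ι]
    {B : X → ι} {ρ : Restriction X} {C : Term X} {i : ι} {L : List ι}
    (h : blockList B ρ C = i :: L) : ∃ y, B y = i ∧ ρ y = none := by
  unfold blockList at h
  cases hc : ((C.map Prod.fst).filter fun x => decide (ρ x = none)).map B with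
  | nil => simp [hc, firstDedup] at h
  | cons a l =>
    rw [hc, firstDedup, List.cons.injEq] at h
    have hmem : a ∈ ((C.map Prod.fst).filter fun x => decide (ρ x = none)).map B := by
      rw [hc]; simp
    obtain ⟨y, hy, hya⟩ := List.mem_map.mp hmem
    exact ⟨y, hya.trans h.1, by simpa using (List.mem_filter.mp hy).2⟩

section Blocks

variable {X ι : Type} [Fintype X] [LinearOrder X] [DecidableEq ι]

theorem gRes_of_eq_some (B : X → ι) {ρ : Restriction X} {x : X} {b : Bool} (h : ρ x = some b) :
    gRes B ρ x = some b := by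
  simp [gRes, h]

theorem gRes_ne_none (B : X → ι) {ρ : Restriction X} {x : X} (h : ρ x ≠ none) :
    gRes B ρ x ≠ none := by
  simp [gRes, h]

/-- The first starred variable of a block is starred, lies in the block, and is minimal. -/
theorem blockStars_head?_eq_some {B : X → ι} {ρ : Restriction X} {i : ι} {x : X}
    (h : (blockStars B ρ i).head? = some x) :
    B x = i ∧ ρ x = none ∧ ∀ y, B y = i → ρ y = none → x ≤ y := by
  obtain ⟨t, ht⟩ := List.head?_eq_some_iff.mp h
  have hmem : ∀ y, y ∈ blockStars B ρ i ↔ B y = i ∧ ρ y = none := by simp [blockStars]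
  have hsort : (blockStars B ρ i).Pairwise (· ≤ ·) := Finset.pairwise_sort _ _
  rw [ht] at hmem hsort
  obtain ⟨h1, h2⟩ := (hmem x).mp (by simp)
  refine ⟨h1, h2, fun y hy hy' => ?_⟩
  rcases List.mem_cons.mp ((hmem y).mpr ⟨hy, hy'⟩) with rfl | hyt
  · exact le_rfl
  · exact (List.pairwise_cons.mp hsort).1 y hyt

theorem blockStars_head?_ne_none {B : X → ι} {ρ : Restriction X} {x : X} (h : ρ x = none) :
    (blockStars B ρ (B x)).head? ≠ none := by
  intro h0
  have hx : x ∈ blockStars B ρ (B x) := by simp [blockStars, h]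
  rw [List.head?_eq_none_iff.mp h0] at hx
  simp at hx

/-- Answering the query of a block and applying `g` commute. -/
theorem gRes_setBlock {B : X → ι} {ρ : Restriction X} {i : ι} {x : X} (b : Bool)
    (h : (blockStars B ρ i).head? = some x) :
    gRes B (setBlock B ρ i x b) = setVar (gRes B ρ) x b := by
  obtain ⟨rfl, hx, hmin⟩ := blockStars_head?_eq_some h
  funext y
  by_cases hy : B y = B x
  · have hg : gRes B (setBlock B ρ (B x) x b) y = setBlock B ρ (B x) x b y := by
      simp [gRes, setBlock_eq_none_iff, hy]
    rw [hg]
    by_cases hyx : y = x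
    · subst hyx
      simp [setBlock, setVar, hx]
    · by_cases hn : ρ y = none
      · have hlt : x < y := lt_of_le_of_ne (hmin y hy hn) (Ne.symm hyx)
        have : ∃ z, B z = B y ∧ ρ z = none ∧ z < y := ⟨x, hy.symm, hx, hlt⟩
        simp [setBlock, setVar, gRes, hy, hn, hyx, hy ▸ this]
      · simp [setBlock, setVar, gRes, hn, hyx]
  · have hyx : y ≠ x := fun e => hy (e ▸ rfl)
    have hs : setBlock B ρ (B x) x b y = ρ y := by simp [setBlock, hy]
    have hiff : (∃ z, B z = B y ∧ setBlock B ρ (B x) x b z = none ∧ z < y) ↔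
        ∃ z, B z = B y ∧ ρ z = none ∧ z < y := by
      refine exists_congr fun z => and_congr_right fun hz => ?_
      simp [setBlock_eq_none_iff, hz, hy]
    simp only [gRes, setVar, hs, hiff, if_neg hyx]

/-- The branch `bp` decides `F↾g(ρ)` correctly, queries only blocks with a starred variable,
each at most once, and each query fixes its whole block. -/
structure IsCorrectBranch (B : X → ι) (F : DNF X) (ρ : Restriction X)
    (bp : List (X × Bool) × Bool) : Prop where
  sat : bp.2 = true → ∃ C ∈ F, satisfied (extendL (gRes B ρ) bp.1) C = true
  fals : bp.2 = false → ∀ C ∈ F, falsified (extendL (gRes B ρ) bp.1) C = true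
  starred : ∀ e ∈ bp.1, ∃ y, B y = B e.1 ∧ ρ y = none
  nodup : (bp.1.map fun e => B e.1).Nodup
  fixed : ∀ k : ℕ, ∀ e ∈ bp.1.take k, ∀ x, B x = B e.1 →
    extendL (gRes B ρ) (bp.1.take k) x ≠ none

theorem IsCorrectBranch.leaf_true {B : X → ι} {F : DNF X} {ρ : Restriction X} {C : Term X}
    (hC : C ∈ F) (hs : satisfied ρ C = true) : IsCorrectBranch B F ρ ([], true) where
  sat _ := ⟨C, hC, satisfied_mono (fun _ _ => gRes_of_eq_some B) hs⟩
  fals h := by simp at h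
  starred := by simp
  nodup := by simp
  fixed := by simp

theorem IsCorrectBranch.leaf_false {B : X → ι} {F : DNF X} {ρ : Restriction X}
    (hf : ∀ C ∈ F, falsified ρ C = true) : IsCorrectBranch B F ρ ([], false) where
  sat h := by simp at h
  fals _ C hC := falsified_mono (fun _ _ => gRes_of_eq_some B) (hf C hC)
  starred := by simp
  nodup := by simp
  fixed := by simp

theorem IsCorrectBranch.cons {B : X → ι} {F : DNF X} {ρ : Restriction X} {i : ι} {x : X}
    {b : Bool} {bp : List (X × Bool) × Bool} (hx : (blockStars B ρ i).head? = some x)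
    (h : IsCorrectBranch B F (setBlock B ρ i x b) bp) :
    IsCorrectBranch B F ρ ((x, b) :: bp.1, bp.2) := by
  have hext : ∀ l, extendL (gRes B ρ) ((x, b) :: l) =
      extendL (gRes B (setBlock B ρ i x b)) l := by
    intro l
    rw [gRes_setBlock b hx]
    rfl
  obtain ⟨rfl, hxn, -⟩ := blockStars_head?_eq_some hx
  refine ⟨?_, ?_, ?_, ?_, ?_⟩
  · simpa only [hext] using h.sat
  · simpa only [hext] using h.fals
  · intro e he
    rcases List.mem_cons.mp he with rfl | he
    · exact ⟨x, rfl, hxn⟩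
    · obtain ⟨y, hy, hyn⟩ := h.starred e he
      exact ⟨y, hy, (setBlock_eq_none_iff.mp hyn).2⟩
  · refine List.nodup_cons.mpr ⟨fun hmem => ?_, h.nodup⟩
    obtain ⟨e, he, hex⟩ := List.mem_map.mp hmem
    obtain ⟨y, hy, hyn⟩ := h.starred e he
    exact (setBlock_eq_none_iff.mp hyn).1 (hy.trans hex)
  · intro k e he y hy
    cases k with
    | zero => simp at he
    | succ k =>
      rw [List.take_succ_cons] at he ⊢
      rw [hext]
      rcases List.mem_cons.mp he with rfl | he
      · exact extendL_ne_none _ (gRes_ne_none B fun h0 => (setBlock_eq_none_iff.mp h0).1 hy)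
      · exact h.fixed k e he y hy

/-- The number of starred variables of a restriction. -/
def starCount (ρ : Restriction X) : ℕ := (Finset.univ.filter fun x => ρ x = none).card

theorem starCount_setBlock_lt {B : X → ι} {ρ : Restriction X} {i : ι} {x : X} (b : Bool)
    (hx : (blockStars B ρ i).head? = some x) :
    starCount (setBlock B ρ i x b) < starCount ρ := by
  obtain ⟨hi, hxn, -⟩ := blockStars_head?_eq_some hx
  refine Finset.card_lt_card (Finset.ssubset_iff_of_subset ?_ |>.mpr ⟨x, ?_, ?_⟩)
  · intro y
    simp only [Finset.mem_filter, Finset.mem_univ, true_and, setBlock_eq_none_iff]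
    exact And.right
  · simpa using hxn
  · simp [setBlock_eq_none_iff, hi]

theorem isCorrectBranch_of_mem_branches_node {B : X → ι} {F : DNF X} {ρ : Restriction X} {i : ι}
    {x : X} {t : Bool → DTree X} (hx : (blockStars B ρ i).head? = some x)
    (h : ∀ b, ∀ bp ∈ (t b).branches, IsCorrectBranch B F (setBlock B ρ i x b) bp) :
    ∀ bp ∈ (DTree.node x (t false) (t true)).branches, IsCorrectBranch B F ρ bp := by
  intro bp hbp
  simp only [DTree.branches, List.mem_append, List.mem_map] at hbp
  rcases hbp with ⟨p, hp, rfl⟩ | ⟨p, hp, rfl⟩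
  · exact (h false p hp).cons hx
  · exact (h true p hp).cons hx

theorem isCorrectBranch_queryBlocks {B : X → ι} {F : DNF X} {C : Term X} (hC : C ∈ F)
    {k : Restriction X → DTree X} {n : ℕ}
    (hk : ∀ ρ, starCount ρ < n → ∀ bp ∈ (k ρ).branches, IsCorrectBranch B F ρ bp)
    (L : List ι) : ∀ ρ, starCount ρ < n →
      ∀ bp ∈ (queryBlocks k B C L ρ).branches, IsCorrectBranch B F ρ bp := by
  induction L with
  | nil =>
    intro ρ hρ bp hbp
    rw [queryBlocks] at hbp
    split_ifs at hbp with hs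
    · rw [DTree.branches, List.mem_singleton] at hbp
      exact hbp ▸ IsCorrectBranch.leaf_true hC hs
    · exact hk ρ hρ bp hbp
  | cons i L ih =>
    intro ρ hρ
    rw [queryBlocks]
    split
    · exact ih ρ hρ
    · rename_i x hx
      exact isCorrectBranch_of_mem_branches_node
        (t := fun b => queryBlocks k B C L (setBlock B ρ i x b)) hx
        fun b => ih _ ((starCount_setBlock_lt b hx).trans hρ)

/-- With more fuel than starred variables, every branch of the canonical tree is correct. -/
theorem isCorrectBranch_canonTreeB (B : X → ι) (F : DNF X) (fuel : ℕ) :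
    ∀ ρ, starCount ρ < fuel → ∀ bp ∈ (canonTreeB B fuel F ρ).branches,
      IsCorrectBranch B F ρ bp := by
  induction fuel with
  | zero => exact fun ρ hρ => absurd hρ (Nat.not_lt_zero _)
  | succ n ih =>
    intro ρ hρ
    rw [canonTreeB]
    split
    · rename_i hnone
      intro bp hbp
      rw [DTree.branches, List.mem_singleton] at hbp
      exact hbp ▸ IsCorrectBranch.leaf_false (by simpa using List.find?_eq_none.mp hnone)
    · rename_i C hsome
      have hC : C ∈ F := List.mem_of_find?_eq_some hsome
      have hf : falsified ρ C = false := by simpa using List.find?_some hsome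
      cases hL : blockList B ρ C with
      | nil =>
        have hs := satisfied_of_not_falsified hf (blockList_eq_nil hL)
        intro bp hbp
        rw [queryBlocks, if_pos hs, DTree.branches, List.mem_singleton] at hbp
        exact hbp ▸ IsCorrectBranch.leaf_true hC hs
      | cons i L =>
        obtain ⟨y, rfl, hy⟩ := blockList_eq_cons hL
        rw [queryBlocks]
        split
        · rename_i h0
          exact absurd h0 (blockStars_head?_ne_none hy)
        · rename_i x hx
          exact isCorrectBranch_of_mem_branches_node
            (t := fun b => queryBlocks (fun ρ' => canonTreeB B n F ρ') B C L
              (setBlock B ρ (B y) x b)) hx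
            fun b => isCorrectBranch_queryBlocks hC ih L _
              (lt_of_lt_of_le (starCount_setBlock_lt b hx) (Nat.lt_succ_iff.mp hρ))

end Blocks

/-- **Correctness of the canonical decision tree for block restrictions.**
For every branch of `T(F,ρ)`, with `π` the assignment given by the answers along it:
the output label equals the truth value of `F↾g(ρ)π` (label `1` means some term of `F`
is satisfied by `g(ρ)π`, label `0` means every term of `F` is falsified by `g(ρ)π`).
Moreover, along any branch no block is queried more than once, and the moment a block
is queried all of its variables are given `0`/`1` values. -/
theorem canonTB_correct {X ι : Type} [Fintype X] [LinearOrder X]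
    [Fintype ι] [DecidableEq ι] (B : X → ι)
    (r : ℕ) (F : DNF X) (hF : IsRDNF r F)
    (ρ : Restriction X) (hρ : BlockRes B ρ) :
    ∀ bp ∈ (canonTB B F ρ).branches,
      (bp.2 = true → ∃ C ∈ F, satisfied (extendL (gRes B ρ) bp.1) C = true) ∧
      (bp.2 = false → ∀ C ∈ F, falsified (extendL (gRes B ρ) bp.1) C = true) ∧
      (bp.1.map fun e => B e.1).Nodup ∧
      (∀ k : ℕ, ∀ e ∈ bp.1.take k, ∀ x, B x = B e.1 →
        extendL (gRes B ρ) (bp.1.take k) x ≠ none) := by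
  intro bp hbp
  have h := isCorrectBranch_canonTreeB B F _ ρ (Nat.lt_succ_of_le (Finset.card_le_univ _)) bp hbp
  exact ⟨h.sat, h.fals, h.nodup, h.fixed⟩
end

section
/- Let X be partitioned into blocks with weights given by parameters 0 < p, q < 1. Let ρ be a block restriction and let σ be an assignment extending ρ which fully sets exactly s distinct *-blocks of ρ, setting m of their starred variables to 1 and all their remaining starred variables to 0. Then the weight of ρσ is at least ((1-p)/p)^m · ((1-q)/q)^s times the weight of ρ. -/
/-- The block weight splits into a product over variables and a product over blocks. -/
lemma blockWeight_eq_prod_mul_prod {X ι : Type} [Fintype X] [Fintype ι] [DecidableEq ι]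
    (p q : ℝ) (B : X → ι) (ρ : Restriction X) :
    blockWeight p q B ρ = (∏ x, if ρ x = some true then 1 - p else p) *
      ∏ i, if ∃ x, B x = i ∧ ρ x = some false then 1 - q
        else if ∃ x, B x = i ∧ ρ x = none then q else 1 := by
  rw [blockWeight, Finset.prod_mul_distrib, Finset.prod_fiberwise]

/-- **Weight change under fully setting `*`-blocks.**
Let `ρ` be a block restriction and `ρ'` an extension of `ρ` which fully sets exactly
the `s` distinct `*`-blocks in `J`, setting `m` of their starred variables to `1` and
all their remaining starred variables to `0` (and agreeing with `ρ` elsewhere). Then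
the weight of `ρ'` is at least `((1-p)/p)^m · ((1-q)/q)^s` times the weight of `ρ`. -/
theorem blockWeight_extend {X ι : Type} [Fintype X] [Fintype ι] [DecidableEq ι]
    (B : X → ι) (p q : ℝ) (hp0 : 0 < p) (hp1 : p < 1) (hq0 : 0 < q) (hq1 : q < 1)
    (ρ ρ' : Restriction X) (hρ : BlockRes B ρ)
    (J : Finset ι) (s m : ℕ) (hJ : J.card = s)
    (hstar : ∀ i ∈ J, ∃ x, B x = i ∧ ρ x = none)
    (hout : ∀ x, B x ∉ J → ρ' x = ρ x)
    (hkeep : ∀ x, B x ∈ J → ρ x ≠ none → ρ' x = ρ x)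
    (hfull : ∀ x, B x ∈ J → ρ x = none → ρ' x ≠ none)
    (hm : (Finset.univ.filter fun x => B x ∈ J ∧ ρ x = none ∧ ρ' x = some true).card = m) :
    ((1 - p) / p) ^ m * ((1 - q) / q) ^ s * blockWeight p q B ρ
      ≤ blockWeight p q B ρ' := by
  classical
  have hvar : ((1 - p) / p) ^ m * (∏ x, if ρ x = some true then 1 - p else p) =
      ∏ x, if ρ' x = some true then 1 - p else p := by
    rw [← hm, ← Finset.prod_const, Finset.prod_filter, ← Finset.prod_mul_distrib]
    refine Finset.prod_congr rfl fun x _ => ?_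
    by_cases hx : B x ∈ J
    · by_cases hn : ρ x = none
      · by_cases ht : ρ' x = some true
        · simp [hx, hn, ht, hp0.ne']
        · simp [hn, ht]
      · simp [hn, hkeep x hx hn]
    · simp [hx, hout x hx]
  have hblock : ((1 - q) / q) ^ s *
      (∏ i, if ∃ x, B x = i ∧ ρ x = some false then 1 - q
        else if ∃ x, B x = i ∧ ρ x = none then q else 1) ≤
      ∏ i, if ∃ x, B x = i ∧ ρ' x = some false then 1 - q
        else if ∃ x, B x = i ∧ ρ' x = none then q else 1 := by
    have hpow : ((1 - q) / q) ^ s = ∏ i, if i ∈ J then (1 - q) / q else 1 := by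
      rw [Finset.prod_ite_mem, Finset.univ_inter, Finset.prod_const, hJ]
    rw [hpow, ← Finset.prod_mul_distrib]
    have hq : 0 ≤ 1 - q := sub_nonneg.2 hq1.le
    refine Finset.prod_le_prod (fun i _ => ?_) fun i _ => ?_
    · split_ifs <;> positivity
    · by_cases hi : i ∈ J
      · obtain ⟨y, hy, hyn⟩ := hstar i hi
        have hfalse : ¬ ∃ x, B x = i ∧ ρ x = some false := by
          rintro ⟨x, hx, hxf⟩
          rcases hρ i with h | h
          · exact h x hx hxf
          · exact h y hy hyn
        have hnone : ¬ ∃ x, B x = i ∧ ρ' x = none := by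
          rintro ⟨x, rfl, hxn⟩
          by_cases hx : ρ x = none
          · exact hfull x hi hx hxn
          · exact hx (hkeep x hi hx ▸ hxn)
        rw [if_pos hi, if_neg hfalse, if_pos ⟨y, hy, hyn⟩, if_neg hnone,
          div_mul_cancel₀ _ hq0.ne']
        split_ifs <;> linarith
      · have hagree : ∀ v, (∃ x, B x = i ∧ ρ' x = v) ↔ ∃ x, B x = i ∧ ρ x = v := fun v =>
          exists_congr fun x => and_congr_right fun hx => by rw [hout x (hx ▸ hi)]
        simp only [hi, hagree, if_false, one_mul, le_refl]
  have hnonneg : 0 ≤ ∏ x, if ρ' x = some true then 1 - p else p :=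
    Finset.prod_nonneg fun x _ => by split_ifs <;> linarith
  rw [blockWeight_eq_prod_mul_prod, blockWeight_eq_prod_mul_prod, mul_mul_mul_comm, hvar]
  exact mul_le_mul_of_nonneg_left hblock hnonneg
end
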